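/- Let a be a non-negative integer and, in S = K[x_1, …, x_4] over a field K, let I_1 = B(x_1 x_3, x_2^2) and I_2 = B(x_1^2 x_3^2 x_4^a, x_2^4 x_4^a). Then the cubic binomial F = (T^{(1)}_{x_1x_3})^2 · T^{(2)}_{x_2^4x_4^a} − (T^{(1)}_{x_2^2})^2 · T^{(2)}_{x_1^2x_3^2x_4^a} belongs to the toric ideal T(I_1 ⊕ I_2), but F does not belong to the ideal generated by the homogeneous elements of T(I_1 ⊕ I_2) of degree at most 2; hence T(I_1 ⊕ I_2) has a minimal generator of degree 3. -/

import Mathlib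

/-- A marked binomial: the difference of two monomials (given by exponent vectors),
with `head` chosen as the marked term. -/
structure MarkedBinomial (V : Type*) where
  head : V →₀ ℕ
  tail : V →₀ ℕ

/-- The polynomial associated to a marked binomial. -/
noncomputable def MarkedBinomial.toPoly {V : Type*} (K : Type*) [Field K]
    (g : MarkedBinomial V) : MvPolynomial V K :=
  MvPolynomial.monomial g.head 1 - MvPolynomial.monomial g.tail 1

/-- Transport a marked binomial along a map of variables. -/
noncomputable def MarkedBinomial.map {V W : Type*} (f : V → W) (g : MarkedBinomial V) :
    MarkedBinomial W :=
  ⟨Finsupp.mapDomain f g.head, Finsupp.mapDomain f g.tail⟩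

/-- A monomial order on the exponent vectors `V →₀ ℕ`: a strict total order, compatible
with addition, for which `1` (the zero exponent vector) is the smallest monomial. -/
structure MonomialOrd (V : Type*) where
  gt : (V →₀ ℕ) → (V →₀ ℕ) → Prop
  irrefl : ∀ m, ¬ gt m m
  trans : ∀ {m₁ m₂ m₃}, gt m₁ m₂ → gt m₂ m₃ → gt m₁ m₃
  total : ∀ m₁ m₂, m₁ ≠ m₂ → gt m₁ m₂ ∨ gt m₂ m₁
  add_right : ∀ {m₁ m₂} (m₃), gt m₁ m₂ → gt (m₁ + m₃) (m₂ + m₃)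
  gt_zero : ∀ m, m ≠ 0 → gt m 0

/-- `m` is the initial (leading) exponent of `f` with respect to the strict order `gt`. -/
def IsInitialTerm {V K : Type*} [Field K] (gt : (V →₀ ℕ) → (V →₀ ℕ) → Prop)
    (f : MvPolynomial V K) (m : V →₀ ℕ) : Prop :=
  m ∈ f.support ∧ ∀ m' ∈ f.support, m' ≠ m → gt m m'

/-- A set `G` of marked binomials is a Gröbner basis of the ideal `J` with respect to the
order `gt`, with the marked terms as initial terms: `G ⊆ J`, each marked term is the
initial term of its binomial, and the marked terms generate the initial ideal of `J`. -/
def IsMarkedGB {V K : Type*} [Field K] (gt : (V →₀ ℕ) → (V →₀ ℕ) → Prop)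
    (G : Set (MarkedBinomial V)) (J : Ideal (MvPolynomial V K)) : Prop :=
  (∀ g ∈ G, g.toPoly K ∈ J) ∧ (∀ g ∈ G, gt g.head g.tail) ∧
    Ideal.span ((fun g => (MvPolynomial.monomial g.head (1 : K) : MvPolynomial V K)) '' G) =
      Ideal.span {p : MvPolynomial V K |
        ∃ f ∈ J, f ≠ 0 ∧ ∃ m, IsInitialTerm gt f m ∧ p = MvPolynomial.monomial m (1 : K)}

/-- One-step reduction of a monomial (exponent vector) with respect to a collection of
marked binomials: replace an occurrence of a marked term by the corresponding tail. -/
def Reduces {V : Type*} (G : Set (MarkedBinomial V)) (m m' : V →₀ ℕ) : Prop :=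
  ∃ g ∈ G, g.head ≤ m ∧ m' = m - g.head + g.tail

/-- One-step reduction of a polynomial with respect to a collection of marked binomials. -/
noncomputable def PolyReduces {V K : Type*} [Field K] (G : Set (MarkedBinomial V))
    (f f' : MvPolynomial V K) : Prop :=
  ∃ g ∈ G, ∃ m ∈ f.support, g.head ≤ m ∧
    f' = f - MvPolynomial.monomial (m - g.head) (MvPolynomial.coeff m f) * g.toPoly K

/-- The image monomial (in the `W`-variables) of a monomial `T` in the `V`-variables under
the monomial map sending the variable `v` to the monomial with exponent vector `u v`. -/
noncomputable def fiberMap {V W : Type*} (u : V → (W →₀ ℕ)) (T : V →₀ ℕ) : W →₀ ℕ :=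
  T.sum fun v e => e • u v

/-- `T` is a sink of the fiber graph over the multidegree `μ` (with respect to the
marked binomials `G` and the monomial map determined by `u`): it lies in the fiber and
has no outgoing edge inside the fiber. -/
noncomputable def IsFiberSink {V W : Type*} (G : Set (MarkedBinomial V)) (u : V → (W →₀ ℕ))
    (μ : W →₀ ℕ) (T : V →₀ ℕ) : Prop :=
  fiberMap u T = μ ∧ ∀ T', Reduces G T T' → fiberMap u T' ≠ μ

/-- `I` is a monomial ideal. -/
def IsMonomialIdeal {n : ℕ} {K : Type*} [Field K] (I : Ideal (MvPolynomial (Fin n) K)) : Prop :=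
  ∃ M : Set (Fin n →₀ ℕ), I = Ideal.span ((fun m => (MvPolynomial.monomial m (1 : K))) '' M)

/-- `I` is a strongly stable (Borel) ideal: a monomial ideal such that whenever `x_i`
divides a monomial `m ∈ I` and `j < i`, also `x_j · m / x_i ∈ I`. -/
def StronglyStable {n : ℕ} {K : Type*} [Field K] (I : Ideal (MvPolynomial (Fin n) K)) : Prop :=
  IsMonomialIdeal I ∧ ∀ m : Fin n →₀ ℕ, MvPolynomial.monomial m (1 : K) ∈ I →
    ∀ i j : Fin n, j < i → m i ≠ 0 →
      MvPolynomial.monomial (m - Finsupp.single i 1 + Finsupp.single j 1) (1 : K) ∈ I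

/-- The smallest strongly stable ideal containing the given monomials. -/
noncomputable def smallestStronglyStable {n : ℕ} (K : Type*) [Field K]
    (Ms : Set (Fin n →₀ ℕ)) : Ideal (MvPolynomial (Fin n) K) :=
  sInf {I | StronglyStable I ∧ ∀ m ∈ Ms, MvPolynomial.monomial m (1 : K) ∈ I}

/-- The minimal monomial generators of an ideal generated in the single degree `d`:
the degree-`d` monomials lying in `I`. -/
def MinGens {n : ℕ} {K : Type*} [Field K] (I : Ideal (MvPolynomial (Fin n) K)) (d : ℕ) :
    Set (Fin n →₀ ℕ) :=
  {m | (m.sum fun _ e => e) = d ∧ MvPolynomial.monomial m (1 : K) ∈ I}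

/-- `u ≻_rlex v` (reverse lexicographic, `x_1 > … > x_n`, for exponent vectors of equal
total degree): at the largest index where they differ, `u` has the smaller exponent. -/
def RlexGt {n : ℕ} (u v : Fin n →₀ ℕ) : Prop :=
  ∃ k : Fin n, u k < v k ∧ ∀ l : Fin n, k < l → u l = v l

/-- The (degree-)reverse lexicographic order on monomials of `K[V]` induced by the strict
variable order `vgt` (where `vgt k l` means the variable `k` is greater than `l`). -/
def VarRevlexGt {V : Type*} (vgt : V → V → Prop) (m m' : V →₀ ℕ) : Prop :=
  (m.sum fun _ e => e) > (m'.sum fun _ e => e) ∨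
    ((m.sum fun _ e => e) = (m'.sum fun _ e => e) ∧
      ∃ k, m k < m' k ∧ ∀ l, vgt k l → m l = m' l)

/-- The minimal monomial generators of the strongly stable ideal `B(x_a x_b)` (`a ≤ b`):
the monomials `x_i x_j` with `i ≤ j`, `i ≤ a`, `j ≤ b`. -/
def BM {n : ℕ} (a b : Fin n) : Set (Fin n →₀ ℕ) :=
  {m | ∃ i j : Fin n, i ≤ j ∧ i ≤ a ∧ j ≤ b ∧ m = Finsupp.single i 1 + Finsupp.single j 1}

/-- The minimal monomial generators of `B(x_c x_d)` not in `B(x_a x_b)` (for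
`c < a ≤ b < d`): the monomials `x_i x_j` with `i ≤ c` and `b < j ≤ d`. -/
def BN {n : ℕ} (b c d : Fin n) : Set (Fin n →₀ ℕ) :=
  {m | ∃ i j : Fin n, i ≤ c ∧ b < j ∧ j ≤ d ∧ m = Finsupp.single i 1 + Finsupp.single j 1}

/-- `u ≻_mrlex v`: every element of `B_N` is greater than every element of `B_M`, and
within `B_M` (resp. `B_N`) the order agrees with `≻_rlex`. -/
def MrlexGt {n : ℕ} (a b c d : Fin n) (u v : Fin n →₀ ℕ) : Prop :=
  (u ∈ BN b c d ∧ v ∈ BM a b) ∨ (u ∈ BM a b ∧ v ∈ BM a b ∧ RlexGt u v) ∨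
    (u ∈ BN b c d ∧ v ∈ BN b c d ∧ RlexGt u v)

/-- The collection `G₁` of marked binomials `T_u T_v − T_{u'} T_{v'}` with `u v = u' v'`
and `u, v ≻_rlex v'`, marked at `T_u T_v`. -/
def G1 {n : ℕ} (a b c d : Fin n) : Set (MarkedBinomial ↥(BM a b ∪ BN b c d)) :=
  {g | ∃ u v u' v' : ↥(BM a b ∪ BN b c d),
    (u : Fin n →₀ ℕ) + (v : Fin n →₀ ℕ) = (u' : Fin n →₀ ℕ) + (v' : Fin n →₀ ℕ) ∧
    RlexGt (u : Fin n →₀ ℕ) (v' : Fin n →₀ ℕ) ∧ RlexGt (v : Fin n →₀ ℕ) (v' : Fin n →₀ ℕ) ∧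
    g.head = Finsupp.single u 1 + Finsupp.single v 1 ∧
    g.tail = Finsupp.single u' 1 + Finsupp.single v' 1}

/-- The collection `G₂` of marked binomials `T_u T_v − T_{u'} T_{v'}` with `u v = u' v'`
and `u, v ≻_mrlex v'`, marked at `T_u T_v`. -/
def G2 {n : ℕ} (a b c d : Fin n) : Set (MarkedBinomial ↥(BM a b ∪ BN b c d)) :=
  {g | ∃ u v u' v' : ↥(BM a b ∪ BN b c d),
    (u : Fin n →₀ ℕ) + (v : Fin n →₀ ℕ) = (u' : Fin n →₀ ℕ) + (v' : Fin n →₀ ℕ) ∧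
    MrlexGt a b c d (u : Fin n →₀ ℕ) (v' : Fin n →₀ ℕ) ∧
    MrlexGt a b c d (v : Fin n →₀ ℕ) (v' : Fin n →₀ ℕ) ∧
    g.head = Finsupp.single u 1 + Finsupp.single v 1 ∧
    g.tail = Finsupp.single u' 1 + Finsupp.single v' 1}

/-- `w` is the smallest (with respect to the variable order induced by `≻_rlex`) variable
factor of the monomial `T` whose underlying monomial lies in `S`. -/
def IsLeastFactorIn {n : ℕ} {V : Set (Fin n →₀ ℕ)} (S : Set (Fin n →₀ ℕ))
    (T : ↥V →₀ ℕ) (w : ↥V) : Prop :=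
  w ∈ T.support ∧ (w : Fin n →₀ ℕ) ∈ S ∧
    ∀ v ∈ T.support, (v : Fin n →₀ ℕ) ∈ S →
      v = w ∨ RlexGt (v : Fin n →₀ ℕ) (w : Fin n →₀ ℕ)

/-- `m` is the `≻_rlex`-smallest element of `S` dividing `μ`. -/
def IsLeastDivisorIn {n : ℕ} (S : Set (Fin n →₀ ℕ)) (μ m : Fin n →₀ ℕ) : Prop :=
  m ∈ S ∧ m ≤ μ ∧ ∀ m' ∈ S, m' ≤ μ → m' = m ∨ RlexGt m' m

/-- `I₁ = B(x₁x₃, x₂²)` in `K[x₁, …, x₄]`. -/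
noncomputable def Iex19_1 (K : Type) [Field K] : Ideal (MvPolynomial (Fin 4) K) :=
  smallestStronglyStable K
    {Finsupp.single (0 : Fin 4) 1 + Finsupp.single 2 1,
     Finsupp.single (1 : Fin 4) 2}

/-- `I₂ = B(x₁²x₃²x₄^a, x₂⁴x₄^a)` in `K[x₁, …, x₄]`. -/
noncomputable def Iex19_2 (K : Type) [Field K] (a : ℕ) : Ideal (MvPolynomial (Fin 4) K) :=
  smallestStronglyStable K
    {Finsupp.single (0 : Fin 4) 2 + Finsupp.single 2 2 + Finsupp.single 3 a,
     Finsupp.single (1 : Fin 4) 4 + Finsupp.single 3 a}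

/-- The toric map `T^{(i)}_u ↦ u·t_i` for the pair `I₁, I₂`. -/
noncomputable def phi19 (K : Type) [Field K] (a : ℕ) :
    MvPolynomial (↥(MinGens (Iex19_1 K) 2) ⊕ ↥(MinGens (Iex19_2 K a) (a + 4))) K
      →ₐ[K] MvPolynomial (Fin 4 ⊕ Fin 2) K :=
  MvPolynomial.aeval (Sum.elim
    (fun u => MvPolynomial.monomial
      (Finsupp.mapDomain Sum.inl (u : Fin 4 →₀ ℕ) + Finsupp.single (Sum.inr 0) 1) 1)
    (fun v => MvPolynomial.monomial
      (Finsupp.mapDomain Sum.inl (v : Fin 4 →₀ ℕ) + Finsupp.single (Sum.inr 1) 1) 1))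

/-- The algebra map sending variables to monomials acts on exponent vectors as `fiberMap`. -/
theorem aeval_monomial_eq_monomial_fiberMap {V W K : Type*} [Field K] (u : V → (W →₀ ℕ))
    (n : V →₀ ℕ) (c : K) :
    MvPolynomial.aeval (fun v => (MvPolynomial.monomial (u v) 1 : MvPolynomial W K))
      (MvPolynomial.monomial n c) = MvPolynomial.monomial (fiberMap u n) c := by
  classical
  rw [MvPolynomial.aeval_monomial, MvPolynomial.algebraMap_eq]
  simp only [MvPolynomial.monomial_pow, one_pow, fiberMap, Finsupp.sum, Finsupp.prod]
  rw [← MvPolynomial.monomial_sum_one, MvPolynomial.C_mul_monomial, mul_one]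

theorem fiberMap_add {V W : Type*} (u : V → (W →₀ ℕ)) (m n : V →₀ ℕ) :
    fiberMap u (m + n) = fiberMap u m + fiberMap u n :=
  map_add (Finsupp.linearCombination ℕ u) m n

theorem fiberMap_single {V W : Type*} (u : V → (W →₀ ℕ)) (v : V) (e : ℕ) :
    fiberMap u (Finsupp.single v e) = e • u v :=
  Finsupp.linearCombination_single ℕ e v

/-- An element of a toric ideal has no term whose fiber is a singleton. -/
theorem coeff_eq_zero_of_fiber_subsingleton {V W K : Type*} [Field K] (u : V → (W →₀ ℕ))
    {f : MvPolynomial V K}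
    (hf : MvPolynomial.aeval
      (fun v => (MvPolynomial.monomial (u v) 1 : MvPolynomial W K)) f = 0)
    {j : V →₀ ℕ} (hj : ∀ k, fiberMap u k = fiberMap u j → k = j) :
    MvPolynomial.coeff j f = 0 := by
  classical
  have h := congrArg (MvPolynomial.coeff (fiberMap u j)) hf
  rw [f.as_sum, map_sum, MvPolynomial.coeff_sum] at h
  simp only [aeval_monomial_eq_monomial_fiberMap, MvPolynomial.coeff_monomial,
    MvPolynomial.coeff_zero] at h
  by_contra hne
  rw [Finset.sum_eq_single j] at h
  · simp [hne] at h
  · intro k _ hk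
    exact if_neg fun hk' => hk (hj k hk')
  · intro hk
    simpa using hk

/-- If every divisor of degree at most `d` of the monomial `m` is alone in its fiber, then `m`
does not occur in the ideal generated by the toric forms of degree at most `d`. -/
theorem coeff_eq_zero_of_mem_span_homogeneous {V W K : Type*} [Field K] (u : V → (W →₀ ℕ))
    (d : ℕ) (m : V →₀ ℕ)
    (hm : ∀ i j, i + j = m → j.degree ≤ d → ∀ k, fiberMap u k = fiberMap u j → k = j)
    {x : MvPolynomial V K}
    (hx : x ∈ Ideal.span {f : MvPolynomial V K |
      MvPolynomial.aeval (fun v => (MvPolynomial.monomial (u v) 1 : MvPolynomial W K)) f = 0 ∧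
        ∃ e : ℕ, e ≤ d ∧ f.IsHomogeneous e}) :
    MvPolynomial.coeff m x = 0 := by
  classical
  suffices h : ∀ p : MvPolynomial V K, MvPolynomial.coeff m (p * x) = 0 by simpa using h 1
  refine Submodule.span_induction (p := fun x _ => ∀ p : MvPolynomial V K,
    MvPolynomial.coeff m (p * x) = 0) ?_ ?_ ?_ ?_ hx
  · rintro f ⟨hf, e, he, hfe⟩ p
    rw [MvPolynomial.coeff_mul]
    refine Finset.sum_eq_zero fun ij hij => ?_
    by_cases hd : ij.2.degree ≤ d
    · rw [coeff_eq_zero_of_fiber_subsingleton u hf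
        (hm ij.1 ij.2 (Finset.HasAntidiagonal.mem_antidiagonal.mp hij) hd), mul_zero]
    · rw [hfe.coeff_eq_zero (by omega), mul_zero]
  · simp
  · intro x y _ _ hx hy p
    rw [mul_add, MvPolynomial.coeff_add, hx, hy, add_zero]
  · intro a x _ hx p
    rw [smul_eq_mul, ← mul_assoc]
    exact hx _

/-- A condition on exponents that is inherited by multiples and preserved by Borel moves holds
on the smallest strongly stable ideal as soon as it holds on its Borel generators. -/
theorem of_monomial_mem_smallestStronglyStable {n : ℕ} {K : Type*} [Field K]
    {Ms : Set (Fin n →₀ ℕ)} (P : (Fin n →₀ ℕ) → Prop) (hMs : ∀ m ∈ Ms, P m)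
    (hup : ∀ m m', m ≤ m' → P m → P m')
    (hborel : ∀ m, P m → ∀ i j : Fin n, j < i → m i ≠ 0 →
      P (m - Finsupp.single i 1 + Finsupp.single j 1))
    {m : Fin n →₀ ℕ} (hm : MvPolynomial.monomial m (1 : K) ∈ smallestStronglyStable K Ms) :
    P m := by
  classical
  have key : ∀ m : Fin n →₀ ℕ, MvPolynomial.monomial m (1 : K) ∈
      Ideal.span ((fun m => (MvPolynomial.monomial m (1 : K))) '' {m | P m}) ↔ P m := by
    intro m
    rw [MvPolynomial.mem_ideal_span_monomial_image]
    constructor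
    · intro h
      obtain ⟨s, hs, hle⟩ := h m (by simp [MvPolynomial.mem_support_iff])
      exact hup s m hle hs
    · intro h k hk
      have hk' : k = m := by
        by_contra hne
        simp [MvPolynomial.mem_support_iff, Ne.symm hne] at hk
      exact ⟨m, h, hk'.ge⟩
  rw [smallestStronglyStable, Ideal.mem_sInf] at hm
  refine (key m).mp (hm ⟨⟨⟨_, rfl⟩, fun m hm i j hji hi => ?_⟩, fun m hm => (key m).mpr (hMs m hm)⟩)
  exact (key _).mpr (hborel m ((key m).mp hm) i j hji hi)

theorem exponents_of_mem_minGens_Iex19_1 {K : Type} [Field K] {u : Fin 4 →₀ ℕ}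
    (hu : u ∈ MinGens (Iex19_1 K) 2) :
    u 0 + u 1 + u 2 + u 3 = 2 ∧ u 3 = 0 ∧ u 2 ≤ u 0 := by
  obtain ⟨hd, hmem⟩ := hu
  rw [Finsupp.sum_fintype _ _ (fun _ => rfl), Fin.sum_univ_four] at hd
  have h := of_monomial_mem_smallestStronglyStable
    (fun m => (1 ≤ m 0 ∧ 2 ≤ m 0 + m 1 + m 2) ∨ 2 ≤ m 0 + m 1) ?_ ?_ ?_ hmem
  · omega
  · rintro m (rfl | rfl) <;> simp
  · intro m m' hle h
    have := hle 0
    have := hle 1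
    have := hle 2
    omega
  · intro m h i j hji hi
    fin_cases i <;> fin_cases j <;> simp at hji hi ⊢ <;> omega

theorem exponents_of_mem_minGens_Iex19_2 {K : Type} [Field K] {a : ℕ} {w : Fin 4 →₀ ℕ}
    (hw : w ∈ MinGens (Iex19_2 K a) (a + 4)) (hw3 : w 3 = a) :
    w 0 + w 1 + w 2 = 4 ∧ (w 2 = 0 ∨ 2 ≤ w 0) := by
  obtain ⟨hd, hmem⟩ := hw
  rw [Finsupp.sum_fintype _ _ (fun _ => rfl), Fin.sum_univ_four] at hd
  have h := of_monomial_mem_smallestStronglyStable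
    (fun m => (2 ≤ m 0 ∧ 4 ≤ m 0 + m 1 + m 2) ∨ 4 ≤ m 0 + m 1) ?_ ?_ ?_ hmem
  · omega
  · rintro m (rfl | rfl) <;> simp
  · intro m m' hle h
    have := hle 0
    have := hle 1
    have := hle 2
    omega
  · intro m h i j hji hi
    fin_cases i <;> fin_cases j <;> simp at hji hi ⊢ <;> omega

/-- The exponent vectors `u·t_i` of the images of the toric variables under a map
`T^{(i)}_u ↦ u·t_i` for two sets of monomials. -/
noncomputable def toricExponent {n : ℕ} (A B : Set (Fin n →₀ ℕ)) :
    ↥A ⊕ ↥B → (Fin n ⊕ Fin 2 →₀ ℕ) :=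
  Sum.elim
    (fun u => Finsupp.mapDomain Sum.inl (u : Fin n →₀ ℕ) + Finsupp.single (Sum.inr 0) 1)
    (fun v => Finsupp.mapDomain Sum.inl (v : Fin n →₀ ℕ) + Finsupp.single (Sum.inr 1) 1)

section ToricExponent

variable {n : ℕ} {A B : Set (Fin n →₀ ℕ)}

@[simp]
theorem toricExponent_inl_inl (u : ↥A) (i : Fin n) :
    toricExponent A B (Sum.inl u) (Sum.inl i) = (u : Fin n →₀ ℕ) i := by
  simp [toricExponent, Finsupp.mapDomain_apply Sum.inl_injective]

@[simp]
theorem toricExponent_inr_inl (w : ↥B) (i : Fin n) :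
    toricExponent A B (Sum.inr w) (Sum.inl i) = (w : Fin n →₀ ℕ) i := by
  simp [toricExponent, Finsupp.mapDomain_apply Sum.inl_injective]

@[simp]
theorem toricExponent_inl_inr (u : ↥A) (i : Fin 2) :
    toricExponent A B (Sum.inl u) (Sum.inr i) = if i = 0 then 1 else 0 := by
  have h := Finsupp.mapDomain_of_notMem_range (u : Fin n →₀ ℕ) (Sum.inr i)
    (f := (Sum.inl : Fin n → Fin n ⊕ Fin 2)) (by simp)
  simp [toricExponent, h, Finsupp.single_apply, eq_comm]

@[simp]
theorem toricExponent_inr_inr (w : ↥B) (i : Fin 2) :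
    toricExponent A B (Sum.inr w) (Sum.inr i) = if i = 1 then 1 else 0 := by
  have h := Finsupp.mapDomain_of_notMem_range (w : Fin n →₀ ℕ) (Sum.inr i)
    (f := (Sum.inl : Fin n → Fin n ⊕ Fin 2)) (by simp)
  simp [toricExponent, h, Finsupp.single_apply, eq_comm]

end ToricExponent

/-- If the variable `c` divides the image of a monomial, it divides the image of one of its
variables. -/
theorem exists_eq_single_add_of_fiberMap_apply_ne_zero {V W : Type*} (u : V → (W →₀ ℕ))
    {k : V →₀ ℕ} {c : W} (h : fiberMap u k c ≠ 0) :
    ∃ v k', u v c ≠ 0 ∧ k = Finsupp.single v 1 + k' := by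
  classical
  rw [fiberMap, Finsupp.sum, Finsupp.finsetSum_apply] at h
  obtain ⟨v, hv, hne⟩ := Finset.exists_ne_zero_of_sum_ne_zero h
  refine ⟨v, k - Finsupp.single v 1, fun h0 => hne (by simp [h0]), ?_⟩
  rw [add_tsub_cancel_of_le]
  rw [Finsupp.single_le_iff]
  exact Nat.one_le_iff_ne_zero.mpr (Finsupp.mem_support_iff.mp hv)

/-- A monomial whose image has degree `2` in `t_1` and `1` in `t_2` is a product of two variables
of the first kind and one of the second kind. -/
theorem exists_eq_of_fiberMap_toricExponent {n : ℕ} {A B : Set (Fin n →₀ ℕ)}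
    {k : ↥A ⊕ ↥B →₀ ℕ}
    (h0 : fiberMap (toricExponent A B) k (Sum.inr 0) = 2)
    (h1 : fiberMap (toricExponent A B) k (Sum.inr 1) = 1) :
    ∃ u u' w, k = Finsupp.single (Sum.inl u) 1 + (Finsupp.single (Sum.inl u') 1 +
      Finsupp.single (Sum.inr w) 1) := by
  obtain ⟨u | w, k, hu, rfl⟩ := exists_eq_single_add_of_fiberMap_apply_ne_zero
    (toricExponent A B) (k := k) (c := Sum.inr 0) (by omega)
  swap
  · simp at hu
  simp [fiberMap_add, fiberMap_single] at h0 h1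
  obtain ⟨u' | w, k, hu, rfl⟩ := exists_eq_single_add_of_fiberMap_apply_ne_zero
    (toricExponent A B) (k := k) (c := Sum.inr 0) (by omega)
  swap
  · simp at hu
  simp [fiberMap_add, fiberMap_single] at h0 h1
  obtain ⟨u | w, k, hu, rfl⟩ := exists_eq_single_add_of_fiberMap_apply_ne_zero
    (toricExponent A B) (k := k) (c := Sum.inr 1) (by omega)
  · simp at hu
  simp [fiberMap_add, fiberMap_single] at h0 h1
  refine ⟨u, u', w, ?_⟩
  suffices hk : k = 0 by rw [hk, add_zero]
  ext v
  by_contra hv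
  have hk : k = Finsupp.single v 1 + (k - Finsupp.single v 1) := by
    rw [add_tsub_cancel_of_le]
    rw [Finsupp.single_le_iff]
    exact Nat.one_le_iff_ne_zero.mpr hv
  rw [hk] at h0 h1
  rcases v with v | v <;> simp [fiberMap_add, fiberMap_single] at h0 h1 <;> omega

theorem phi19_eq_aeval (K : Type) [Field K] (a : ℕ) :
    phi19 K a = MvPolynomial.aeval (fun v => (MvPolynomial.monomial
      (toricExponent (MinGens (Iex19_1 K) 2) (MinGens (Iex19_2 K a) (a + 4)) v) 1)) := by
  unfold phi19
  congr 1
  funext v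
  rcases v with v | v <;> rfl

/-- The fiber of the multidegree of the cubic binomial consists of its two terms. -/
theorem eq_or_eq_of_fiberMap_eq_cubic {K : Type} [Field K] {a : ℕ}
    {v1 v2 : ↥(MinGens (Iex19_1 K) 2)} {w1 w2 : ↥(MinGens (Iex19_2 K a) (a + 4))}
    (hv1 : (v1 : Fin 4 →₀ ℕ) = Finsupp.single (0 : Fin 4) 1 + Finsupp.single 2 1)
    (hv2 : (v2 : Fin 4 →₀ ℕ) = Finsupp.single (1 : Fin 4) 2)
    (hw1 : (w1 : Fin 4 →₀ ℕ) =
      Finsupp.single (0 : Fin 4) 2 + Finsupp.single 2 2 + Finsupp.single 3 a)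
    (hw2 : (w2 : Fin 4 →₀ ℕ) = Finsupp.single (1 : Fin 4) 4 + Finsupp.single 3 a)
    {k : ↥(MinGens (Iex19_1 K) 2) ⊕ ↥(MinGens (Iex19_2 K a) (a + 4)) →₀ ℕ}
    (hk : fiberMap (toricExponent _ _) k = fiberMap (toricExponent _ _)
      (Finsupp.single (Sum.inl v1) 2 + Finsupp.single (Sum.inr w2) 1)) :
    k = Finsupp.single (Sum.inl v1) 2 + Finsupp.single (Sum.inr w2) 1 ∨
      k = Finsupp.single (Sum.inl v2) 2 + Finsupp.single (Sum.inr w1) 1 := by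
  have hc := fun c => DFunLike.congr_fun hk c
  obtain ⟨u, u', w, rfl⟩ := exists_eq_of_fiberMap_toricExponent
    (by rw [hk]; simp [fiberMap_add, fiberMap_single])
    (by rw [hk]; simp [fiberMap_add, fiberMap_single])
  have e0 := hc (Sum.inl 0)
  have e1 := hc (Sum.inl 1)
  have e2 := hc (Sum.inl 2)
  have e3 := hc (Sum.inl 3)
  simp [fiberMap_add, fiberMap_single, hv1, hw2] at e0 e1 e2 e3
  obtain ⟨hu, hu3, hu2⟩ := exponents_of_mem_minGens_Iex19_1 u.2
  obtain ⟨hu', hu'3, hu'2⟩ := exponents_of_mem_minGens_Iex19_1 u'.2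
  obtain ⟨hw, h | h⟩ := exponents_of_mem_minGens_Iex19_2 w.2 (by omega)
  · left
    have h1 : u = v1 := by
      ext i
      rw [hv1]
      fin_cases i <;> simp <;> omega
    have h2 : u' = v1 := by
      ext i
      rw [hv1]
      fin_cases i <;> simp <;> omega
    have h3 : w = w2 := by
      ext i
      rw [hw2]
      fin_cases i <;> simp <;> omega
    rw [h1, h2, h3, ← add_assoc, ← Finsupp.single_add]
  · right
    have h1 : u = v2 := by
      ext i
      rw [hv2]
      fin_cases i <;> simp <;> omega
    have h2 : u' = v2 := by
      ext i
      rw [hv2]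
      fin_cases i <;> simp <;> omega
    have h3 : w = w1 := by
      ext i
      rw [hw1]
      fin_cases i <;> simp <;> omega
    rw [h1, h2, h3, ← add_assoc, ← Finsupp.single_add]

/-- For `I₁ = B(x₁x₃, x₂²)` and `I₂ = B(x₁²x₃²x₄^a, x₂⁴x₄^a)`, the
cubic binomial `F = (T^{(1)}_{x₁x₃})² T^{(2)}_{x₂⁴x₄^a} − (T^{(1)}_{x₂²})²
T^{(2)}_{x₁²x₃²x₄^a}` lies in the toric ideal `T(I₁ ⊕ I₂)` but not in the ideal
generated by its homogeneous elements of degree at most `2`; hence the toric ideal has a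
minimal generator of degree `3`. -/
theorem toric_cubic_generator_two_ideals_mixed_degrees (K : Type) [Field K] (a : ℕ)
    (v1 : ↥(MinGens (Iex19_1 K) 2))
    (hv1 : (v1 : Fin 4 →₀ ℕ) = Finsupp.single (0 : Fin 4) 1 + Finsupp.single 2 1)
    (v2 : ↥(MinGens (Iex19_1 K) 2))
    (hv2 : (v2 : Fin 4 →₀ ℕ) = Finsupp.single (1 : Fin 4) 2)
    (w1 : ↥(MinGens (Iex19_2 K a) (a + 4)))
    (hw1 : (w1 : Fin 4 →₀ ℕ) =
      Finsupp.single (0 : Fin 4) 2 + Finsupp.single 2 2 + Finsupp.single 3 a)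
    (w2 : ↥(MinGens (Iex19_2 K a) (a + 4)))
    (hw2 : (w2 : Fin 4 →₀ ℕ) = Finsupp.single (1 : Fin 4) 4 + Finsupp.single 3 a) :
    (MvPolynomial.X (Sum.inl v1) ^ 2 * MvPolynomial.X (Sum.inr w2) -
        MvPolynomial.X (Sum.inl v2) ^ 2 * MvPolynomial.X (Sum.inr w1)) ∈
        RingHom.ker (phi19 K a).toRingHom ∧
      (MvPolynomial.X (Sum.inl v1) ^ 2 * MvPolynomial.X (Sum.inr w2) -
        MvPolynomial.X (Sum.inl v2) ^ 2 * MvPolynomial.X (Sum.inr w1)) ∉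
        Ideal.span {f | f ∈ RingHom.ker (phi19 K a).toRingHom ∧
          ∃ e : ℕ, e ≤ 2 ∧ MvPolynomial.IsHomogeneous f e} := by
  classical
  have hv : v1 ≠ v2 := by
    rintro rfl
    have := DFunLike.congr_fun (hv1.symm.trans hv2) 0
    simp at this
  have hw : w1 ≠ w2 := by
    rintro rfl
    have := DFunLike.congr_fun (hw1.symm.trans hw2) 0
    simp at this
  have hmon : ∀ (v : ↥(MinGens (Iex19_1 K) 2)) (w : ↥(MinGens (Iex19_2 K a) (a + 4))),
      (MvPolynomial.X (Sum.inl v) ^ 2 * MvPolynomial.X (Sum.inr w) : MvPolynomial _ K) =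
        MvPolynomial.monomial
          (Finsupp.single (Sum.inl v) 2 + Finsupp.single (Sum.inr w) 1) 1 := by
    intro v w
    rw [MvPolynomial.X_pow_eq_monomial, MvPolynomial.X, MvPolynomial.monomial_mul, one_mul]
  have hker : ∀ f, f ∈ RingHom.ker (phi19 K a).toRingHom ↔
      MvPolynomial.aeval (fun v => (MvPolynomial.monomial (toricExponent _ _ v) (1 : K))) f =
        0 := by
    intro f
    rw [← phi19_eq_aeval]
    rfl
  simp only [hker, hmon]
  constructor
  · rw [map_sub, aeval_monomial_eq_monomial_fiberMap, aeval_monomial_eq_monomial_fiberMap,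
      sub_eq_zero]
    congr 2
    refine Finsupp.ext fun c => ?_
    rcases c with i | i
    · fin_cases i <;>
        simp [fiberMap_add, fiberMap_single, hv1, hv2, hw1, hw2]
    · simp [fiberMap_add, fiberMap_single]
  · intro hmem
    have h := coeff_eq_zero_of_mem_span_homogeneous _ 2
      (Finsupp.single (Sum.inl v1) 2 + Finsupp.single (Sum.inr w2) 1) ?_ hmem
    · rw [MvPolynomial.coeff_sub, MvPolynomial.coeff_monomial, MvPolynomial.coeff_monomial,
        if_pos rfl, if_neg, sub_zero] at h
      · exact one_ne_zero h
      · intro h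
        have := DFunLike.congr_fun h (Sum.inl v1)
        simp [hv.symm] at this
    · intro i j hij hj k hk
      have hik := eq_or_eq_of_fiberMap_eq_cubic hv1 hv2 hw1 hw2 (k := i + k)
        (by rw [← hij, fiberMap_add, fiberMap_add, hk])
      rcases hik with hik | hik
      · exact add_left_cancel (hik.trans hij.symm)
      · exfalso
        have hi : i = 0 := by
          ext x
          have p1 := DFunLike.congr_fun hij x
          have p2 := DFunLike.congr_fun hik x
          rcases x with x | x
          · by_cases hx : v1 = x
            · subst hx
              simp [hv.symm] at p1 p2 ⊢
              omega
            · simp [Finsupp.single_apply, hx] at p1 p2 ⊢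
              omega
          · by_cases hx : w2 = x
            · subst hx
              simp [hw] at p1 p2 ⊢
              omega
            · simp [Finsupp.single_apply, hx] at p1 p2 ⊢
              omega
        rw [hi, zero_add] at hij
        rw [hij, map_add, Finsupp.degree_single, Finsupp.degree_single] at hj
        omega
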